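/- For every real β > 0 and every real p₁ with √β < p₁ < 3√β, one has ((p₁ − 3√β)·(p₁ − √β)³·(p₁(1744 + 99√β) − √β(6256 + 321β))) / (384β) > 0. -/

import Mathlib

/-- For `β > 0` and `√β < p₁ < 3√β`, the quantity `q₂ − q̃₂` from Lemma 9
is positive. -/
theorem lemma9_return_difference_pos (β p₁ : ℝ) (hβ : 0 < β)
    (h1 : Real.sqrt β < p₁) (h2 : p₁ < 3 * Real.sqrt β) :
    0 < ((p₁ - 3 * Real.sqrt β) * (p₁ - Real.sqrt β) ^ 3 *
        (p₁ * (1744 + 99 * Real.sqrt β) - Real.sqrt β * (6256 + 321 * β))) /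
      (384 * β) := by
  have hs : 0 < Real.sqrt β := Real.sqrt_pos.mpr hβ
  have hsq : Real.sqrt β ^ 2 = β := Real.sq_sqrt hβ.le
  set s := Real.sqrt β
  have hlast : p₁ * (1744 + 99 * s) - s * (6256 + 321 * β) < 0 := by
    have hp : p₁ * (1744 + 99 * s) < 3 * s * (1744 + 99 * s) := by gcongr
    have hquad : 0 < s * (1024 - 297 * s + 321 * s ^ 2) :=
      mul_pos hs (by nlinarith [sq_nonneg (2 * s - 1)])
    rw [← hsq]
    linarith
  have hcube : 0 < (p₁ - s) ^ 3 := pow_pos (sub_pos.mpr h1) 3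
  exact div_pos (mul_pos_of_neg_of_neg (mul_neg_of_neg_of_pos (sub_neg.mpr h2) hcube) hlast)
    (by positivity)
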